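/- arXiv:2207.06513 — 3 statements merged into one kernel-verified Lean document; each statement's English description precedes it below -/
import Mathlib

section
/- Let n ≥ 3 and let ϝ be a real number with ϝ > −((n−2)/2)². Then for every smooth compactly supported function φ : ℝⁿ → ℂ with support contained in ℝⁿ \ {0} which is not identically zero, one has ∫_{ℝⁿ} ( ‖∇φ(x)‖² + ϝ |φ(x)|²/|x|² ) dx > 0; that is, the quadratic form ⟨(−Δ + ϝ/r²)φ, φ⟩ of the inverse-square Schrödinger operator is positive definite on C_c^∞(ℝⁿ \ {0}). -/
open MeasureTheory

lemma aux_int {n : ℕ} (F : EuclideanSpace ℝ (Fin n) → ℝ) (hF : ContDiff ℝ 1 F)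
    (hc : HasCompactSupport F) (v : EuclideanSpace ℝ (Fin n)) :
    Integrable (fun x => fderiv ℝ F x v) ∧ ∫ x, fderiv ℝ F x v = 0 := by
  have hcont : Continuous (fun x => fderiv ℝ F x v) :=
    (hF.continuous_fderiv (by norm_num)).clm_apply continuous_const
  have hi : Integrable (fun x => fderiv ℝ F x v) :=
    hcont.integrable_of_hasCompactSupport (hc.fderiv_apply (𝕜 := ℝ) v)
  refine ⟨hi, ?_⟩
  have hFi : Integrable F := hF.continuous.integrable_of_hasCompactSupport hc
  have h := integral_mul_fderiv_eq_neg_fderiv_mul_of_integrable (μ := volume)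
    (f := fun _ : EuclideanSpace ℝ (Fin n) => (1 : ℝ)) (g := F) (v := v)
    (by simp) (by simpa using hi) (by simpa using hFi)
    (fun x _ => differentiableAt_const _) (fun x _ => hF.differentiable (by norm_num) x)
  simpa using h

lemma aux_deriv {n : ℕ} (φ : EuclideanSpace ℝ (Fin n) → ℂ) (x : EuclideanSpace ℝ (Fin n))
    (hx : x ≠ 0) (hφ : DifferentiableAt ℝ φ x) (i : Fin n) :
    fderiv ℝ (fun y : EuclideanSpace ℝ (Fin n) => y i * ((‖y‖ ^ 2)⁻¹ * ‖φ y‖ ^ 2)) x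
      (EuclideanSpace.single i 1) =
      (‖x‖ ^ 2)⁻¹ * ‖φ x‖ ^ 2 - 2 * (x i) ^ 2 * ((‖x‖ ^ 2)⁻¹) ^ 2 * ‖φ x‖ ^ 2
      + 2 * (x i) * (‖x‖ ^ 2)⁻¹ * inner ℝ (φ x) (fderiv ℝ φ x (EuclideanSpace.single i 1)) := by
  have h1 : HasFDerivAt (fun y : EuclideanSpace ℝ (Fin n) => y i)
    (EuclideanSpace.proj i : EuclideanSpace ℝ (Fin n) →L[ℝ] ℝ) x :=
    (EuclideanSpace.proj i : EuclideanSpace ℝ (Fin n) →L[ℝ] ℝ).hasFDerivAt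
  have h2 := (hasFDerivAt_id (𝕜 := ℝ) x).norm_sq
  have hs : ‖x‖ ^ 2 ≠ 0 := by positivity
  have h3 := (hasDerivAt_inv hs).comp_hasFDerivAt x h2
  have h4 := hφ.hasFDerivAt.norm_sq
  have h5 := h1.mul (h3.mul h4)
  have h6 := h5.fderiv
  have h7 := congrArg (fun L => L (EuclideanSpace.single i (1:ℝ))) h6
  refine Eq.trans h7 ?_
  simp [EuclideanSpace.inner_single_right]
  field_simp
  ring

lemma aux_alg {n : ℕ} (a ϝ q s : ℝ) (ha : a = ((n : ℝ) - 2) / 2) (hs : s ≠ 0) (z : ℂ)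
    (hq : q = ‖z‖ ^ 2)
    (x : Fin n → ℝ) (hx : ∑ i, x i ^ 2 = s) (d : Fin n → ℂ) :
    (ϝ + a ^ 2) * (s⁻¹ * q) ≤ ∑ i, ‖d i‖ ^ 2 + ϝ * q / s
      + a * ∑ i, (s⁻¹ * q - 2 * (x i) ^ 2 * (s⁻¹) ^ 2 * q + 2 * x i * s⁻¹ * inner ℝ z (d i)) := by
  have h0 : 0 ≤ ∑ i, ‖d i + (a * x i * s⁻¹) • z‖ ^ 2 :=
    Finset.sum_nonneg fun i _ => by positivity
  have h1 : ∑ i, ‖d i + (a * x i * s⁻¹) • z‖ ^ 2 =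
      ∑ i, ‖d i‖ ^ 2 + a * ∑ i, 2 * x i * s⁻¹ * inner ℝ z (d i)
        + a ^ 2 * (s⁻¹) ^ 2 * q * ∑ i, x i ^ 2 := by
    rw [Finset.mul_sum, Finset.mul_sum, ← Finset.sum_add_distrib, ← Finset.sum_add_distrib]
    refine Finset.sum_congr rfl fun i _ => ?_
    rw [norm_add_sq_real, norm_smul, real_inner_smul_right, real_inner_comm, mul_pow,
      Real.norm_eq_abs, sq_abs, hq]
    ring
  have h2 : ∑ i, (s⁻¹ * q - 2 * (x i) ^ 2 * (s⁻¹) ^ 2 * q + 2 * x i * s⁻¹ * inner ℝ z (d i))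
      = n * (s⁻¹ * q) - 2 * (s⁻¹) ^ 2 * q * ∑ i, x i ^ 2
        + ∑ i, 2 * x i * s⁻¹ * inner ℝ z (d i) := by
    rw [Finset.sum_add_distrib, Finset.sum_sub_distrib, Finset.mul_sum]
    simp only [Finset.sum_const, Finset.card_univ, Fintype.card_fin, nsmul_eq_mul]
    congr 2
    exact Finset.sum_congr rfl fun i _ => by ring
  rw [h2]
  rw [h1] at h0
  rw [hx] at h0 ⊢
  have e1 : (s⁻¹) ^ 2 * s = s⁻¹ := by field_simp
  have e2 : a ^ 2 * (s⁻¹) ^ 2 * q * s = a ^ 2 * (s⁻¹ * q) := by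
    linear_combination a ^ 2 * q * e1
  have e3 : 2 * (s⁻¹) ^ 2 * q * s = 2 * (s⁻¹ * q) := by linear_combination 2 * q * e1
  have e4 : ϝ * q / s = ϝ * (s⁻¹ * q) := by rw [div_eq_mul_inv]; ring
  have e5 : (n : ℝ) = 2 * a + 2 := by rw [ha]; ring
  rw [e2] at h0
  rw [e3, e4, e5]
  nlinarith

theorem stmt4 (n : ℕ) (hn : 3 ≤ n) (ϝ : ℝ)
    (hϝ : -((( n : ℝ) - 2) / 2) ^ 2 < ϝ)
    (φ : EuclideanSpace ℝ (Fin n) → ℂ)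
    (hφ : ContDiff ℝ (⊤ : ℕ∞) φ) (hcpt : HasCompactSupport φ)
    (hsupp : tsupport φ ⊆ {x : EuclideanSpace ℝ (Fin n) | x ≠ 0})
    (hne : φ ≠ 0) :
    0 < ∫ x : EuclideanSpace ℝ (Fin n),
        (∑ i : Fin n, ‖fderiv ℝ φ x (EuclideanSpace.single i 1)‖ ^ 2
          + ϝ * ‖φ x‖ ^ 2 / ‖x‖ ^ 2) := by
  obtain ⟨a, ha⟩ : ∃ a : ℝ, a = ((n : ℝ) - 2) / 2 := ⟨_, rfl⟩
  rw [← ha] at hϝ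
  have h0s : (0 : EuclideanSpace ℝ (Fin n)) ∉ tsupport φ := fun h => hsupp h rfl
  have hz : φ =ᶠ[nhds 0] 0 := notMem_tsupport_iff_eventuallyEq.mp h0s
  have hφ1 : ContDiff ℝ 1 φ := hφ.of_le (by exact_mod_cast le_top)
  let g : EuclideanSpace ℝ (Fin n) → ℝ := fun x => (‖x‖ ^ 2)⁻¹ * ‖φ x‖ ^ 2
  have hg : ContDiff ℝ 1 g := by
    rw [contDiff_iff_contDiffAt]
    intro x
    by_cases hx : x = 0
    · subst hx
      have : g =ᶠ[nhds 0] fun _ => 0 := by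
        filter_upwards [hz] with y hy
        simp [g, hy]
      exact contDiffAt_const.congr_of_eventuallyEq this
    · exact ((contDiff_norm_sq ℝ).contDiffAt.inv (by positivity)).mul
        (hφ1.norm_sq ℝ).contDiffAt
  have hgc : HasCompactSupport g := by
    refine hcpt.mono ?_
    intro x hx h
    exact hx (by simp [g, h])
  have hgi : Integrable g := hg.continuous.integrable_of_hasCompactSupport hgc
  have hF : ∀ i : Fin n, Integrable (fun x => fderiv ℝ
      (fun y : EuclideanSpace ℝ (Fin n) => y i * ((‖y‖ ^ 2)⁻¹ * ‖φ y‖ ^ 2)) x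
      (EuclideanSpace.single i 1)) ∧ ∫ x, fderiv ℝ
      (fun y : EuclideanSpace ℝ (Fin n) => y i * ((‖y‖ ^ 2)⁻¹ * ‖φ y‖ ^ 2)) x
      (EuclideanSpace.single i 1) = 0 := fun i => by
    refine aux_int _ ?_ ?_ _
    · exact (EuclideanSpace.proj i : EuclideanSpace ℝ (Fin n) →L[ℝ] ℝ).contDiff.mul hg
    · exact hgc.mul_left
  have hI1 : Integrable (fun x => ∑ i : Fin n,
      ‖fderiv ℝ φ x (EuclideanSpace.single i 1)‖ ^ 2) := by
    refine integrable_finsetSum _ fun i _ => ?_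
    have hc : Continuous (fun x => fderiv ℝ φ x (EuclideanSpace.single i 1)) :=
      (hφ1.continuous_fderiv (by norm_num)).clm_apply continuous_const
    refine (hc.norm.pow 2).integrable_of_hasCompactSupport ?_
    refine (hcpt.fderiv_apply (𝕜 := ℝ) (EuclideanSpace.single i 1)).mono ?_
    intro x hx h
    have h' : fderiv ℝ φ x (EuclideanSpace.single i 1) = 0 := h
    exact hx (by simp [h'])
  have hI2 : Integrable (fun x => ϝ * ‖φ x‖ ^ 2 / ‖x‖ ^ 2) := by
    refine (hgi.const_mul ϝ).congr (Filter.Eventually.of_forall fun x => ?_)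
    simp only [g]
    rw [div_eq_mul_inv]; ring
  have hI := hI1.add hI2
  have hD := (integrable_finsetSum Finset.univ fun i _ => (hF i).1).const_mul a
  have hpos : 0 < ∫ x, (ϝ + a ^ 2) * g x := by
    rw [integral_const_mul]
    refine mul_pos (by linarith) ?_
    obtain ⟨x, hx⟩ := Function.ne_iff.mp hne
    have hx' : φ x ≠ 0 := hx
    have hx0 : x ≠ 0 := fun h => hx' (by subst h; exact hz.self_of_nhds)
    refine hg.continuous.integral_pos_of_hasCompactSupport_nonneg_nonzero hgc
      (fun y => by simp only [g, Pi.zero_apply]; positivity) (x := x) ?_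
    simp only [g]
    positivity
  have hle := integral_mono (hgi.const_mul (ϝ + a ^ 2)) (hI.add hD) (fun x => by
    by_cases hx : x = 0
    · subst hx
      have h1 : fderiv ℝ φ 0 = 0 := by
        rw [hz.fderiv_eq]; simp
      have h2 : ∀ i : Fin n, fderiv ℝ
          (fun y : EuclideanSpace ℝ (Fin n) => y i * ((‖y‖ ^ 2)⁻¹ * ‖φ y‖ ^ 2)) 0 = 0 := by
        intro i
        have : (fun y : EuclideanSpace ℝ (Fin n) => y i * ((‖y‖ ^ 2)⁻¹ * ‖φ y‖ ^ 2))
            =ᶠ[nhds 0] fun _ => 0 := by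
          filter_upwards [hz] with y hy
          simp [hy]
        rw [this.fderiv_eq]; simp
      simp [g, h1, h2]
    · have := aux_alg a ϝ (‖φ x‖ ^ 2) (‖x‖ ^ 2) ha (by positivity) (φ x) rfl (fun i => x i)
        (EuclideanSpace.real_norm_sq_eq x).symm
        (fun i => fderiv ℝ φ x (EuclideanSpace.single i 1))
      simp only [Pi.add_apply, aux_deriv φ x hx (hφ1.differentiable (by norm_num) x)]
      exact this)
  rw [integral_const_mul] at hpos
  rw [integral_add' hI hD, integral_const_mul, integral_const_mul, integral_finsetSum _ fun i _ => (hF i).1,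
    Finset.sum_eq_zero fun i _ => (hF i).2, mul_zero, add_zero] at hle
  exact lt_of_lt_of_le hpos hle
end

section
/- Let n ≥ 3, j ∈ ℕ, and let p : ℝⁿ → ℂ be a homogeneous polynomial function of degree j with Δp = 0 (Σ_i ∂_i² p = 0). Set λ = j(j+n−2). Let ϝ ∈ ℝ, σ ∈ ℂ, and let w : (0,2) → ℂ be twice continuously differentiable. Define u(t,x) = p(x) |x|^{−j} (t+|x|)^{−(iσ+(n−1)/2)} w(2|x|/(t+|x|)) for t > 0 and x ∈ ℝⁿ \ {0}. Then at every point (t,x) with t > 0, x ≠ 0 and p(x) ≠ 0, one has (∂_t² u − Δ_x u + ϝ |x|^{−2} u)(t,x) = 0 if and only if w satisfies the radial equation with parameters (n,σ,λ,ϝ), namely x̄(1−x̄)w''(x̄) + (n−1 − x̄(n+iσ))w'(x̄) − ((ϝ+λ)/x̄)w(x̄) − ((n−1)/2)(iσ + (n−1)/2)w(x̄) = 0, at the point x̄ = 2|x|/(t+|x|). -/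
open Complex

/-- The Euclidean Laplacian `Δf(x) = Σᵢ ∂ᵢ²f(x)` of a function `f : ℝⁿ → ℂ`. -/
noncomputable def lap {n : ℕ} (f : EuclideanSpace ℝ (Fin n) → ℂ)
    (x : EuclideanSpace ℝ (Fin n)) : ℂ :=
  ∑ i : Fin n,
    fderiv ℝ (fun y => fderiv ℝ f y (EuclideanSpace.single i 1)) x
      (EuclideanSpace.single i 1)

/-- The radial (reduced normal operator) equation with parameters `(n, σ, λ, ϝ)`:
`xb(1−xb)w'' + (n−1 − xb(n+iσ))w' − ((ϝ+λ)/xb)w − ((n−1)/2)(iσ + (n−1)/2)w = 0`. -/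
def radialEq (n : ℕ) (σ : ℂ) (lam ϝ : ℝ) (w : ℝ → ℂ) (xb : ℝ) : Prop :=
  (xb : ℂ) * (1 - (xb : ℂ)) * deriv (deriv w) xb
    + ((n : ℂ) - 1 - (xb : ℂ) * ((n : ℂ) + Complex.I * σ)) * deriv w xb
    - ((ϝ : ℂ) + (lam : ℂ)) / (xb : ℂ) * w xb
    - ((n : ℂ) - 1) / 2 * (Complex.I * σ + ((n : ℂ) - 1) / 2) * w xb = 0


abbrev EE (n : ℕ) := EuclideanSpace ℝ (Fin n)

lemma aux_norm {n : ℕ} (x : EE n) (hx : x ≠ 0) :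
    HasFDerivAt (fun y : EE n => ‖y‖) (‖x‖⁻¹ • innerSL ℝ x) x := by
  have h := ((hasStrictFDerivAt_norm_sq x).hasFDerivAt).sqrt (by simpa using hx)
  have h1 : (fun y : EE n => √(‖y‖ ^ 2)) = fun y => ‖y‖ := by
    funext y; exact Real.sqrt_sq (norm_nonneg y)
  rw [h1] at h
  have h2 : ‖x‖⁻¹ • innerSL ℝ x = (1 / (2 * √(‖x‖ ^ 2))) • 2 • (innerSL ℝ) x := by
    ext v
    have : ‖x‖ ≠ 0 := norm_ne_zero_iff.mpr hx
    simp only [Real.sqrt_sq (norm_nonneg x), smul_apply, smul_eq_mul,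
      nsmul_eq_mul]
    field_simp
    simp
  rw [h2]
  exact h

lemma aux_comp {n : ℕ} (g : ℝ → ℂ) (g' : ℂ) (x : EE n) (hx : x ≠ 0)
    (hg : HasDerivAt g g' ‖x‖) :
    ∃ L : EE n →L[ℝ] ℂ, HasFDerivAt (fun y : EE n => g ‖y‖) L x ∧
      ∀ i, L (EuclideanSpace.single i 1) = g' / (‖x‖ : ℂ) * (x i : ℂ) := by
  have h := hg.hasFDerivAt.comp x (aux_norm x hx)
  refine ⟨_, h, fun i => ?_⟩
  simp [EuclideanSpace.inner_single_right]
  ring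

lemma aux_hom {n j : ℕ} (P : MvPolynomial (Fin n) ℂ) (hP : P.IsHomogeneous j) (c : ℂ)
    (v : Fin n → ℂ) :
    MvPolynomial.eval (fun i => c * v i) P = c ^ j * MvPolynomial.eval v P := by
  rw [MvPolynomial.eval_eq', MvPolynomial.eval_eq', Finset.mul_sum]
  refine Finset.sum_congr rfl fun d hd => ?_
  have h := hP (MvPolynomial.mem_support_iff.mp hd)
  simp only [mul_pow, Finset.prod_mul_distrib, Finset.prod_pow_eq_pow_sum]
  have h2 : ∑ i, d i = j := by
    rw [← h]
    simp [Finsupp.weight_apply, Finsupp.sum_fintype]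
  rw [h2]; ring

lemma aux_smooth {n : ℕ} (P : MvPolynomial (Fin n) ℂ) :
    ContDiff ℝ 2 (fun x : EE n => MvPolynomial.eval (fun i => ((x i : ℝ) : ℂ)) P) := by
  induction P using MvPolynomial.induction_on with
  | C a => simpa using contDiff_const
  | add p q hp hq => simpa using hp.add hq
  | mul_X p i hp =>
    simp only [map_mul, MvPolynomial.eval_X]
    refine hp.mul ?_
    exact Complex.ofRealCLM.contDiff.comp (by fun_prop)

lemma aux_euler {n j : ℕ} (p : EE n → ℂ) (hp : ContDiff ℝ 2 p)
    (hh : ∀ (c : ℝ) x, p (c • x) = (c : ℂ) ^ j * p x) (x : EE n) :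
    ∑ i, (x i : ℂ) * fderiv ℝ p x (EuclideanSpace.single i 1) = j * p x := by
  have hx : x = ∑ i, x i • (EuclideanSpace.single i 1 : EE n) := by
    ext k; simp [Finset.sum_apply, Pi.single_apply]
  have h1 : fderiv ℝ p x x = ∑ i, (x i : ℂ) * fderiv ℝ p x (EuclideanSpace.single i 1) := by
    generalize fderiv ℝ p x = L
    conv_lhs => rw [hx]
    simp [map_sum]
  rw [← h1]
  have hd : HasFDerivAt p (fderiv ℝ p x) ((1 : ℝ) • x) := by
    rw [one_smul]; exact (hp.differentiable (by norm_num) x).hasFDerivAt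
  have h2 := hd.comp_hasDerivAt (1 : ℝ) ((hasDerivAt_id (1 : ℝ)).smul_const x)
  have h3 : HasDerivAt (fun c : ℝ => (c : ℂ) ^ j * p x) (j * p x) 1 := by
    have := ((hasDerivAt_id ((1 : ℝ) : ℂ)).pow j).comp_ofReal.mul_const (p x)
    simpa using this
  have h4 := h2.unique (h3.congr_of_eventuallyEq
    (Filter.Eventually.of_forall fun c => by simpa using hh c x))
  simpa using h4

lemma aux_lap {n j : ℕ} (p : EE n → ℂ) (hp : ContDiff ℝ 2 p)
    (hh : ∀ (c : ℝ) x, p (c • x) = (c : ℂ) ^ j * p x) (hharm : ∀ x, lap p x = 0)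
    (g g1 g2 : ℝ → ℂ) (hg : ∀ r, 0 < r → HasDerivAt g (g1 r) r)
    (hg1 : ∀ r, 0 < r → HasDerivAt g1 (g2 r) r) (x : EE n) (hx : x ≠ 0) :
    lap (fun y => p y * g ‖y‖) x =
      p x * (g2 ‖x‖ + (n - 1 + 2 * j) / (‖x‖ : ℂ) * g1 ‖x‖) := by
  have hr : 0 < ‖x‖ := norm_pos_iff.mpr hx
  have hrc : (‖x‖ : ℂ) ≠ 0 := by exact_mod_cast hr.ne'
  have hpd : ∀ y, HasFDerivAt p (fderiv ℝ p y) y := fun y =>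
    (hp.differentiable (by norm_num) y).hasFDerivAt
  -- first derivatives
  have first : ∀ i : Fin n, ∀ y : EE n, y ≠ 0 →
      fderiv ℝ (fun y => p y * g ‖y‖) y (EuclideanSpace.single i 1) =
        p y * ((g1 ‖y‖ / (‖y‖ : ℂ)) * (y i : ℂ))
          + g ‖y‖ * fderiv ℝ p y (EuclideanSpace.single i 1) := by
    intro i y hy
    obtain ⟨L, hL, hLi⟩ := aux_comp g _ y hy (hg _ (norm_pos_iff.mpr hy))
    have := ((hpd y).mul hL).fderiv
    change fderiv ℝ (fun y => p y * g ‖y‖) y = _ at this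
    rw [this]
    simp [hLi]
  have second : ∀ i : Fin n,
      fderiv ℝ (fun y => fderiv ℝ (fun y => p y * g ‖y‖) y (EuclideanSpace.single i 1)) x
        (EuclideanSpace.single i 1) =
      p x * (g1 ‖x‖ / (‖x‖ : ℂ))
      + p x * ((g2 ‖x‖ * ‖x‖ - g1 ‖x‖) / (‖x‖ : ℂ) ^ 3) * ((x i : ℝ) : ℂ) ^ 2
      + 2 * (g1 ‖x‖ / (‖x‖ : ℂ)) * ((x i : ℂ) * fderiv ℝ p x (EuclideanSpace.single i 1))
      + g ‖x‖ * fderiv ℝ (fun y => fderiv ℝ p y (EuclideanSpace.single i 1)) x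
        (EuclideanSpace.single i 1) := by
    intro i
    have hev : (fun y => fderiv ℝ (fun y => p y * g ‖y‖) y (EuclideanSpace.single i 1))
        =ᶠ[nhds x] fun y => p y * ((g1 ‖y‖ / (‖y‖ : ℂ)) * (y i : ℂ))
          + g ‖y‖ * fderiv ℝ p y (EuclideanSpace.single i 1) := by
      filter_upwards [isOpen_ne.mem_nhds hx] with y hy using first i y hy
    rw [hev.fderiv_eq]
    obtain ⟨L, hL, hLi⟩ := aux_comp g _ x hx (hg _ hr)
    have hq : HasDerivAt (fun r : ℝ => g1 r / (r : ℂ))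
        ((g2 ‖x‖ * ‖x‖ - g1 ‖x‖ * 1) / (‖x‖ : ℂ) ^ 2) ‖x‖ :=
      (hg1 _ hr).div (hasDerivAt_id (‖x‖ : ℂ)).comp_ofReal hrc
    obtain ⟨M, hM, hMi⟩ := aux_comp (fun r : ℝ => g1 r / (r : ℂ)) _ x hx hq
    have hc : HasFDerivAt (fun y : EE n => (y i : ℂ))
        (Complex.ofRealCLM.comp (EuclideanSpace.proj i : EE n →L[ℝ] ℝ)) x :=
      (Complex.ofRealCLM.comp (EuclideanSpace.proj i : EE n →L[ℝ] ℝ)).hasFDerivAt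
    have hpi : HasFDerivAt (fun y => fderiv ℝ p y (EuclideanSpace.single i 1))
        (fderiv ℝ (fun y => fderiv ℝ p y (EuclideanSpace.single i 1)) x) x := by
      apply DifferentiableAt.hasFDerivAt
      have : ContDiff ℝ 1 (fderiv ℝ p) := hp.fderiv_right (by norm_num)
      exact (this.differentiable (by norm_num) x).clm_apply (differentiableAt_const _)
    have hfin := (((hpd x).mul (hM.mul hc)).add (hL.mul hpi)).fderiv
    change fderiv ℝ (fun y => p y * ((g1 ‖y‖ / (‖y‖ : ℂ)) * (y i : ℂ))
          + g ‖y‖ * fderiv ℝ p y (EuclideanSpace.single i 1)) x = _ at hfin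
    rw [hfin]
    simp [hLi, hMi]
    field_simp
    ring
  have hlap := hharm x
  unfold lap at hlap ⊢
  simp only [second, Finset.sum_add_distrib, ← Finset.mul_sum, hlap, aux_euler p hp hh x]
  have hsq : ∑ i, ((x i : ℝ) : ℂ) ^ 2 = (‖x‖ : ℂ) ^ 2 := by
    have := EuclideanSpace.real_norm_sq_eq x
    exact_mod_cast this.symm
  rw [hsq]
  simp
  field_simp
  ring

lemma aux_pow (a : ℂ) (s : ℝ) (hs : 0 < s) :
    HasDerivAt (fun s : ℝ => (s : ℂ) ^ (-a)) (-a * (s : ℂ) ^ (-a) / s) s := by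
  have hsc : (s : ℂ) ≠ 0 := by exact_mod_cast hs.ne'
  have := ((hasDerivAt_id (s : ℂ)).cpow_const (c := -a) (by simp [hs])).comp_ofReal
  simp only [id, mul_one] at this
  rw [Complex.cpow_sub _ _ hsc, Complex.cpow_one] at this
  rw [mul_div_assoc]
  exact this

lemma aux_w (w : ℝ → ℂ) (hw : ContDiffOn ℝ 2 w (Set.Ioo 0 2)) (y : ℝ) (hy : y ∈ Set.Ioo (0:ℝ) 2) :
    HasDerivAt w (deriv w y) y ∧ HasDerivAt (deriv w) (deriv (deriv w) y) y := by
  have ho : IsOpen (Set.Ioo (0:ℝ) 2) := isOpen_Ioo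
  constructor
  · exact ((hw.contDiffAt (ho.mem_nhds hy)).differentiableAt (by norm_num)).hasDerivAt
  · have : ContDiffOn ℝ 1 (deriv w) (Set.Ioo 0 2) := hw.deriv_of_isOpen ho (by norm_num)
    exact ((this.contDiffAt (ho.mem_nhds hy)).differentiableAt (by norm_num)).hasDerivAt

/-- chain rule for a complex power times a composed function -/
lemma aux_chain (a : ℂ) (v : ℝ → ℂ) (v' : ℂ) (s y : ℝ → ℝ) (s' y' : ℝ) (r : ℝ) (hs : 0 < s r)
    (hsd : HasDerivAt s s' r) (hyd : HasDerivAt y y' r) (hv : HasDerivAt v v' (y r)) :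
    HasDerivAt (fun r => ((s r : ℝ) : ℂ) ^ (-a) * v (y r))
      (((s r : ℝ) : ℂ) ^ (-a) * (-a * s' / s r * v (y r) + y' * v')) r := by
  have h1 := (aux_pow a (s r) hs).scomp r hsd
  have h2 := hv.scomp r hyd
  have h3 := h1.mul h2
  have h4 : ((s r : ℝ) : ℂ) ^ (-a) * (-a * s' / s r * v (y r) + y' * v') =
      s' • (-a * ((s r : ℝ) : ℂ) ^ (-a) / (s r : ℂ)) * v (y r)
        + ((s r : ℝ) : ℂ) ^ (-a) * (y' • v') := by
    simp only [Complex.real_smul]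
    ring
  rw [h4]
  exact h3

lemma aux_step (a : ℂ) (v : ℝ → ℂ) (v' : ℂ) (s y : ℝ → ℝ) (e : ℝ) (r : ℝ) (hs : 0 < s r)
    (hsd : HasDerivAt s 1 r) (hyd : HasDerivAt y ((e - y r) / s r) r)
    (hv : HasDerivAt v v' (y r)) :
    HasDerivAt (fun r => ((s r : ℝ) : ℂ) ^ (-a) * v (y r))
      (((s r : ℝ) : ℂ) ^ (-(a + 1)) * (-a * v (y r) + ((e : ℂ) - (y r : ℂ)) * v')) r := by
  have hsc : ((s r : ℝ) : ℂ) ≠ 0 := by exact_mod_cast hs.ne'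
  have h := aux_chain a v v' s y _ _ r hs hsd hyd hv
  have h4 : ((s r : ℝ) : ℂ) ^ (-(a + 1)) * (-a * v (y r) + ((e : ℂ) - (y r : ℂ)) * v') =
      ((s r : ℝ) : ℂ) ^ (-a) * (-a * ((1 : ℝ) : ℂ) / s r * v (y r)
        + (((e - y r) / s r : ℝ) : ℂ) * v') := by
    rw [neg_add, Complex.cpow_add _ _ hsc, Complex.cpow_neg_one]
    push_cast
    field_simp
  rw [h4]
  exact h

lemma aux_step2 (a : ℂ) (w : ℝ → ℂ) (hw : ContDiffOn ℝ 2 w (Set.Ioo 0 2)) (s y : ℝ → ℝ) (e : ℝ)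
    (r : ℝ) (hs : 0 < s r) (hy : y r ∈ Set.Ioo (0 : ℝ) 2)
    (hsd : HasDerivAt s 1 r) (hyd : HasDerivAt y ((e - y r) / s r) r) :
    HasDerivAt (fun r => ((s r : ℝ) : ℂ) ^ (-a) * w (y r))
      (((s r : ℝ) : ℂ) ^ (-(a + 1)) * (-a * w (y r) + ((e : ℂ) - (y r : ℂ)) * deriv w (y r))) r ∧
    HasDerivAt (fun r => ((s r : ℝ) : ℂ) ^ (-(a + 1)) *
        (-a * w (y r) + ((e : ℂ) - (y r : ℂ)) * deriv w (y r)))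
      (((s r : ℝ) : ℂ) ^ (-(a + 1 + 1)) * (a * (a + 1) * w (y r)
        - 2 * (a + 1) * ((e : ℂ) - (y r : ℂ)) * deriv w (y r)
        + ((e : ℂ) - (y r : ℂ)) ^ 2 * deriv (deriv w) (y r))) r := by
  obtain ⟨h1, h2⟩ := aux_w w hw _ hy
  refine ⟨aux_step a w _ s y e r hs hsd hyd h1, ?_⟩
  have hid : HasDerivAt (fun z : ℝ => (e : ℂ) - (z : ℂ)) (-1) (y r) := by
    simpa using ((hasDerivAt_id ((y r : ℝ) : ℂ)).comp_ofReal).const_sub (e : ℂ)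
  have hv : HasDerivAt (fun z : ℝ => -a * w z + ((e : ℂ) - (z : ℂ)) * deriv w z)
      (-a * deriv w (y r) + (-1 * deriv w (y r)
        + ((e : ℂ) - (y r : ℂ)) * deriv (deriv w) (y r))) (y r) :=
    (h1.const_mul (-a)).add (hid.mul h2)
  have h := aux_step (a + 1) _ _ s y e r hs hsd hyd hv
  refine h.congr_deriv ?_
  ring

/-- multiplication by `r ^ (-j)` -/
lemma aux_rj (j : ℕ) (F : ℝ → ℂ) (F' : ℂ) (r : ℝ) (hr : 0 < r) (hF : HasDerivAt F F' r) :
    HasDerivAt (fun r : ℝ => ((r : ℂ) ^ j)⁻¹ * F r)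
      (((r : ℂ) ^ j)⁻¹ * (F' - j / (r : ℂ) * F r)) r := by
  have hrc : (r : ℂ) ≠ 0 := by exact_mod_cast hr.ne'
  have h1 := (((hasDerivAt_id (r : ℂ)).pow j).inv (pow_ne_zero j hrc)).comp_ofReal
  have h := h1.mul hF
  refine h.congr_deriv ?_
  rcases j with _ | k
  · simp
  · simp
    field_simp
    ring

lemma aux_lap2 {n j : ℕ} (p : EE n → ℂ) (hp : ContDiff ℝ 2 p)
    (hh : ∀ (c : ℝ) x, p (c • x) = (c : ℂ) ^ j * p x) (hharm : ∀ x, lap p x = 0)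
    (F F1 F2 : ℝ → ℂ) (hF : ∀ r, 0 < r → HasDerivAt F (F1 r) r)
    (hF1 : ∀ r, 0 < r → HasDerivAt F1 (F2 r) r) (x : EE n) (hx : x ≠ 0) :
    lap (fun y => p y * (((‖y‖ : ℂ) ^ j)⁻¹ * F ‖y‖)) x =
      p x * (((‖x‖ : ℂ) ^ j)⁻¹ * (F2 ‖x‖ + (n - 1) / (‖x‖ : ℂ) * F1 ‖x‖
        - j * (j + n - 2) / (‖x‖ : ℂ) ^ 2 * F ‖x‖)) := by
  have hrc : (‖x‖ : ℂ) ≠ 0 := by exact_mod_cast (norm_ne_zero_iff.mpr hx)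
  have h := aux_lap p hp hh hharm (fun r : ℝ => ((r : ℂ) ^ j)⁻¹ * F r)
    (fun r : ℝ => ((r : ℂ) ^ j)⁻¹ * (F1 r - j / (r : ℂ) * F r))
    (fun r : ℝ => ((r : ℂ) ^ j)⁻¹ *
      (F2 r - 2 * j / (r : ℂ) * F1 r + j * (j + 1) / (r : ℂ) ^ 2 * F r))
    (fun r hr => aux_rj j F _ r hr (hF r hr)) (fun r hr => ?_) x hx
  · rw [h]
    generalize ((‖x‖ : ℂ) ^ j)⁻¹ = K
    field_simp
    ring
  · have hr0 : (r : ℂ) ≠ 0 := by exact_mod_cast hr.ne'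
    have hq : HasDerivAt (fun r : ℝ => (j : ℂ) / (r : ℂ)) (-(j : ℂ) / (r : ℂ) ^ 2) r := by
      refine ((hasDerivAt_const r (j : ℂ)).div
        (hasDerivAt_id (r : ℂ)).comp_ofReal hr0).congr_deriv ?_
      simp
    refine (aux_rj j _ _ r hr ((hF1 r hr).sub (hq.mul (hF r hr)))).congr_deriv ?_
    simp only [Pi.sub_apply, Pi.mul_apply]
    generalize ((r : ℂ) ^ j)⁻¹ = K
    field_simp
    ring

/-- Separation of variables for the wave equation with inverse-square potential:
with `p` a harmonic homogeneous polynomial of degree `j`, `λ = j(j+n−2)`, and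
`u(t,x) = p(x)|x|^{−j} (t+|x|)^{−(iσ+(n−1)/2)} w(2|x|/(t+|x|))`, at each point with
`t > 0`, `x ≠ 0`, `p(x) ≠ 0`, one has `∂ₜ²u − Δu + ϝ|x|^{−2}u = 0` iff `w` satisfies
the radial equation at `xb = 2|x|/(t+|x|)`. -/
theorem stmt5 (n j : ℕ) (hn : 3 ≤ n)
    (p : EuclideanSpace ℝ (Fin n) → ℂ)
    (P : MvPolynomial (Fin n) ℂ) (hP : P.IsHomogeneous j)
    (hpP : ∀ x : EuclideanSpace ℝ (Fin n),
      p x = MvPolynomial.eval (fun i => ((x i : ℝ) : ℂ)) P)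
    (hharm : ∀ x, lap p x = 0)
    (ϝ : ℝ) (σ : ℂ)
    (w : ℝ → ℂ) (hw : ContDiffOn ℝ 2 w (Set.Ioo 0 2))
    (u : ℝ → EuclideanSpace ℝ (Fin n) → ℂ)
    (hu : ∀ (t : ℝ) (x : EuclideanSpace ℝ (Fin n)),
      u t x = p x / (‖x‖ : ℂ) ^ j
        * ((t + ‖x‖ : ℝ) : ℂ) ^ (-(Complex.I * σ + ((n : ℂ) - 1) / 2))
        * w (2 * ‖x‖ / (t + ‖x‖)))
    (t : ℝ) (x : EuclideanSpace ℝ (Fin n))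
    (ht : 0 < t) (hx : x ≠ 0) (hpx : p x ≠ 0) :
    (deriv (fun s => deriv (fun s' => u s' x) s) t
        - lap (fun y => u t y) x
        + (ϝ : ℂ) / (‖x‖ : ℂ) ^ 2 * u t x = 0)
      ↔ radialEq n σ ((j * (j + n - 2) : ℕ) : ℝ) ϝ w (2 * ‖x‖ / (t + ‖x‖)) := by
  have hr : 0 < ‖x‖ := norm_pos_iff.mpr hx
  set a : ℂ := Complex.I * σ + ((n : ℂ) - 1) / 2 with ha
  have hp : ContDiff ℝ 2 p := by
    rw [funext hpP]; exact aux_smooth P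
  have hh : ∀ (c : ℝ) x, p (c • x) = (c : ℂ) ^ j * p x := by
    intro c x
    rw [hpP, hpP, ← aux_hom P hP]
    simp
  have hmem : ∀ t r : ℝ, 0 < t → 0 < r → 2 * r / (t + r) ∈ Set.Ioo (0 : ℝ) 2 := by
    intro t r ht hr
    refine ⟨by positivity, ?_⟩
    rw [div_lt_iff₀ (by positivity)]
    linarith
  -- time direction
  have htime : ∀ s : ℝ, 0 < s → _ := fun s (hs : 0 < s) =>
    aux_step2 a w hw (fun s => s + ‖x‖) (fun s => 2 * ‖x‖ / (s + ‖x‖)) 0 s (by positivity)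
      (hmem s _ hs hr) ((hasDerivAt_id s).add_const _) (by
        have h0 : s + ‖x‖ ≠ 0 := by positivity
        refine ((hasDerivAt_const s (2 * ‖x‖)).div
          ((hasDerivAt_id s).add_const ‖x‖) h0).congr_deriv ?_
        simp only [id]
        field_simp)
  have hspace : ∀ r : ℝ, 0 < r → _ := fun r (hr : 0 < r) =>
    aux_step2 a w hw (fun r => t + r) (fun r => 2 * r / (t + r)) 2 r (by positivity)
      (hmem t _ ht hr) ((hasDerivAt_id r).const_add _) (by
        have h0 : t + r ≠ 0 := by positivity
        refine (((hasDerivAt_id r).const_mul 2).div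
          ((hasDerivAt_id r).const_add t) h0).congr_deriv ?_
        simp only [id]
        field_simp)
  have hut : ∀ s, u s x = p x / (‖x‖ : ℂ) ^ j *
      (((s + ‖x‖ : ℝ) : ℂ) ^ (-a) * w (2 * ‖x‖ / (s + ‖x‖))) := by
    intro s; rw [hu, mul_assoc]
  have hux : ∀ y, u t y = p y * (((‖y‖ : ℂ) ^ j)⁻¹ *
      (((t + ‖y‖ : ℝ) : ℂ) ^ (-a) * w (2 * ‖y‖ / (t + ‖y‖)))) := by
    intro s; rw [hu]; ring
  have hd0 : ∀ s : ℝ, 0 < s → _ := fun s hs =>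
    ((htime s hs).1.const_mul (p x / (‖x‖ : ℂ) ^ j)).deriv
  have hd1 := Filter.EventuallyEq.deriv_eq (Filter.Eventually.mono (lt_mem_nhds ht) hd0)
  have hd2 : deriv (fun s => deriv (fun s' => u s' x) s) t = _ :=
    (congrArg (fun f : ℝ → ℂ => deriv (fun s => deriv f s) t) (funext hut)).trans
      (hd1.trans (((htime t ht).2.const_mul (p x / (‖x‖ : ℂ) ^ j)).deriv))
  have hL := aux_lap2 p hp hh hharm _ _ _ (fun r hr => (hspace r hr).1)
    (fun r hr => (hspace r hr).2) x hx
  have hL' : lap (fun y => u t y) x = _ :=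
    (congrArg (fun f => lap f x) (funext hux)).trans hL
  rw [hd2, hL', hux x]
  unfold radialEq
  have hS : 0 < t + ‖x‖ := by positivity
  have hSc : ((t + ‖x‖ : ℝ) : ℂ) ≠ 0 := by exact_mod_cast hS.ne'
  have hrc : (‖x‖ : ℂ) ≠ 0 := by exact_mod_cast hr.ne'
  have hE : ((t + ‖x‖ : ℝ) : ℂ) ^ (-(a + 1 + 1)) ≠ 0 := by
    rw [Complex.cpow_def_of_ne_zero hSc]; exact Complex.exp_ne_zero _
  have hE1 : ((t + ‖x‖ : ℝ) : ℂ) ^ (-(a + 1)) =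
      ((t + ‖x‖ : ℝ) : ℂ) ^ (-(a + 1 + 1)) * ((t + ‖x‖ : ℝ) : ℂ) := by
    rw [show -(a + 1) = -(a + 1 + 1) + 1 by ring, Complex.cpow_add _ _ hSc, Complex.cpow_one]
  have hE0 : ((t + ‖x‖ : ℝ) : ℂ) ^ (-a) =
      ((t + ‖x‖ : ℝ) : ℂ) ^ (-(a + 1 + 1)) * ((t + ‖x‖ : ℝ) : ℂ) ^ 2 := by
    rw [show -a = -(a + 1) + 1 by ring, Complex.cpow_add _ _ hSc, Complex.cpow_one, hE1]
    ring
  have hX : ((2 * ‖x‖ / (t + ‖x‖) : ℝ) : ℂ) = 2 * (‖x‖ : ℂ) / ((t + ‖x‖ : ℝ) : ℂ) := by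
    rw [Complex.ofReal_div, Complex.ofReal_mul, Complex.ofReal_ofNat]
  have hlam : ((((j * (j + n - 2) : ℕ) : ℝ)) : ℂ) = (j : ℂ) * (j + n - 2) := by
    have h : ((j + n - 2 : ℕ) : ℂ) = (j : ℂ) + n - 2 := by
      rw [Nat.cast_sub (by omega)]; push_cast; ring
    rw [Complex.ofReal_natCast, Nat.cast_mul, h]
  have hK : ((‖x‖ : ℂ) ^ j)⁻¹ ≠ 0 := inv_ne_zero (pow_ne_zero j hrc)
  have hIσ : Complex.I * σ = a - ((n : ℂ) - 1) / 2 := by rw [ha]; ring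
  simp only [hE1, hE0, hX, hlam, hIσ, div_eq_mul_inv (p x)]
  generalize ((t + ‖x‖ : ℝ) : ℂ) ^ (-(a + 1 + 1)) = E at *
  generalize ((‖x‖ : ℂ) ^ j)⁻¹ = K at *
  generalize w (2 * ‖x‖ / (t + ‖x‖)) = w0
  generalize deriv w (2 * ‖x‖ / (t + ‖x‖)) = w1
  generalize deriv (deriv w) (2 * ‖x‖ / (t + ‖x‖)) = w2
  generalize ((t + ‖x‖ : ℝ) : ℂ) = S at *
  generalize (‖x‖ : ℂ) = R at *
  have hc : p x * K * E * (-2 * S / R) ≠ 0 := by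
    refine mul_ne_zero (mul_ne_zero (mul_ne_zero hpx hK) hE) ?_
    exact div_ne_zero (mul_ne_zero (by norm_num) hSc) hrc
  refine Iff.trans ?_ (mul_eq_zero_iff_left hc)
  refine Eq.congr ?_ rfl
  push_cast
  field_simp
  ring
end

section
/- Let ℓ, ℓ′ ∈ ℝ and let v : (0,1) × (0,1) → ℂ be a smooth function such that for all j, k ∈ ℕ, sup_{(z,w) ∈ (0,1)²} | z^{−ℓ} w^{−ℓ′} ((z∂_z)^j (w∂_w)^k v)(z,w) | < ∞. Define ṽ(s,w) = v(sw, w) for (s,w) ∈ (0,1) × (0,1). Then for all j, k ∈ ℕ, sup_{(s,w) ∈ (0,1)²} | s^{−ℓ} w^{−(ℓ+ℓ′)} ((s∂_s)^j (w∂_w)^k ṽ)(s,w) | < ∞. -/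
/-- The vector field `z∂_z` acting in the first variable. -/
noncomputable def D1 (f : ℝ → ℝ → ℂ) : ℝ → ℝ → ℂ :=
  fun z w => z * deriv (fun z' => f z' w) z

/-- The vector field `w∂_w` acting in the second variable. -/
noncomputable def D2 (f : ℝ → ℝ → ℂ) : ℝ → ℝ → ℂ :=
  fun z w => w * deriv (fun w' => f z w') w

def QQ : Set (ℝ × ℝ) := Set.Ioo 0 1 ×ˢ Set.Ioo 0 1

def UU (f : ℝ → ℝ → ℂ) : ℝ × ℝ → ℂ := fun p => f p.1 p.2

def Sm (f : ℝ → ℝ → ℂ) : Prop := ContDiffOn ℝ (⊤ : ℕ∞) (UU f) QQ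

def EqQ (f g : ℝ → ℝ → ℂ) : Prop := ∀ z w, (z, w) ∈ QQ → f z w = g z w

def PP (f : ℝ → ℝ → ℂ) : ℝ → ℝ → ℂ := fun s w => f (s * w) w

theorem isOpen_QQ : IsOpen QQ := isOpen_Ioo.prod isOpen_Ioo

theorem Sm.at {f : ℝ → ℝ → ℂ} (h : Sm f) {p : ℝ × ℝ} (hp : p ∈ QQ) :
    ContDiffAt ℝ (⊤ : ℕ∞) (UU f) p := h.contDiffAt (isOpen_QQ.mem_nhds hp)

theorem Sm.diff {f : ℝ → ℝ → ℂ} (h : Sm f) {p : ℝ × ℝ} (hp : p ∈ QQ) :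
    DifferentiableAt ℝ (UU f) p := (h.at hp).differentiableAt (by simp)

theorem ev1 {z w : ℝ} (hp : (z, w) ∈ QQ) : ∀ᶠ z' in nhds z, (z', w) ∈ QQ :=
  (Continuous.prodMk_left w).continuousAt.eventually (isOpen_QQ.mem_nhds hp)

theorem ev2 {z w : ℝ} (hp : (z, w) ∈ QQ) : ∀ᶠ w' in nhds w, (z, w') ∈ QQ :=
  (Continuous.prodMk_right z).continuousAt.eventually (isOpen_QQ.mem_nhds hp)

theorem hasDerivAt_line1 (z w : ℝ) : HasDerivAt (fun z' : ℝ => (z', w)) ((1 : ℝ), (0 : ℝ)) z :=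
  (hasDerivAt_id z).prodMk (hasDerivAt_const z w)

theorem hasDerivAt_line2 (z w : ℝ) : HasDerivAt (fun w' : ℝ => (z, w')) ((0 : ℝ), (1 : ℝ)) w :=
  (hasDerivAt_const w z).prodMk (hasDerivAt_id w)

theorem D1_eq {f : ℝ → ℝ → ℂ} (h : Sm f) {z w : ℝ} (hp : (z, w) ∈ QQ) :
    D1 f z w = z * fderiv ℝ (UU f) (z, w) (1, 0) := by
  have := (HasFDerivAt.comp_hasDerivAt z (h.diff hp).hasFDerivAt (hasDerivAt_line1 z w)).deriv
  simp only [D1]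
  rw [← this]; rfl

theorem D2_eq {f : ℝ → ℝ → ℂ} (h : Sm f) {z w : ℝ} (hp : (z, w) ∈ QQ) :
    D2 f z w = w * fderiv ℝ (UU f) (z, w) (0, 1) := by
  have := (HasFDerivAt.comp_hasDerivAt w (h.diff hp).hasFDerivAt (hasDerivAt_line2 z w)).deriv
  simp only [D2]
  rw [← this]; rfl

theorem EqQ.D1 {f g : ℝ → ℝ → ℂ} (h : EqQ f g) : EqQ (D1 f) (D1 g) := by
  intro z w hp
  have : (fun z' => f z' w) =ᶠ[nhds z] (fun z' => g z' w) := by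
    filter_upwards [ev1 hp] with z' hz' using h _ _ hz'
  simp only [_root_.D1, this.deriv_eq]

theorem EqQ.D2 {f g : ℝ → ℝ → ℂ} (h : EqQ f g) : EqQ (D2 f) (D2 g) := by
  intro z w hp
  have : (fun w' => f z w') =ᶠ[nhds w] (fun w' => g z w') := by
    filter_upwards [ev2 hp] with z' hz' using h _ _ hz'
  simp only [_root_.D2, this.deriv_eq]

theorem EqQ.trans {f g k : ℝ → ℝ → ℂ} (h : EqQ f g) (h' : EqQ g k) : EqQ f k :=
  fun z w hp => (h z w hp).trans (h' z w hp)

theorem EqQ.D1_iter {f g : ℝ → ℝ → ℂ} (h : EqQ f g) (j : ℕ) :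
    EqQ (_root_.D1^[j] f) (_root_.D1^[j] g) := by
  induction j with
  | zero => exact h
  | succ n ih => simp only [Function.iterate_succ_apply']; exact ih.D1

theorem fderiv_smooth {f : ℝ → ℝ → ℂ} (h : Sm f) :
    ContDiffOn ℝ (⊤ : ℕ∞) (fderiv ℝ (UU f)) QQ :=
  ContDiffOn.fderiv_of_isOpen h isOpen_QQ (by simp)

theorem Sm.D1 {f : ℝ → ℝ → ℂ} (h : Sm f) : Sm (D1 f) := by
  have h1 : ContDiffOn ℝ (⊤ : ℕ∞)
      (fun p : ℝ × ℝ => (p.1 : ℂ) * fderiv ℝ (UU f) p (1, 0)) QQ :=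
    ((Complex.ofRealCLM.contDiff.comp contDiff_fst).contDiffOn).mul
      ((fderiv_smooth h).clm_apply contDiffOn_const)
  exact h1.congr fun p hp => D1_eq h (z := p.1) (w := p.2) hp

theorem Sm.D2 {f : ℝ → ℝ → ℂ} (h : Sm f) : Sm (D2 f) := by
  have h1 : ContDiffOn ℝ (⊤ : ℕ∞)
      (fun p : ℝ × ℝ => (p.2 : ℂ) * fderiv ℝ (UU f) p (0, 1)) QQ :=
    ((Complex.ofRealCLM.contDiff.comp contDiff_snd).contDiffOn).mul
      ((fderiv_smooth h).clm_apply contDiffOn_const)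
  exact h1.congr fun p hp => D2_eq h (z := p.1) (w := p.2) hp

theorem Sm.D1_iter {f : ℝ → ℝ → ℂ} (h : Sm f) (j : ℕ) : Sm (_root_.D1^[j] f) := by
  induction j with
  | zero => exact h
  | succ n ih => simp only [Function.iterate_succ_apply']; exact ih.D1

theorem Sm.D2_iter {f : ℝ → ℝ → ℂ} (h : Sm f) (j : ℕ) : Sm (_root_.D2^[j] f) := by
  induction j with
  | zero => exact h
  | succ n ih => simp only [Function.iterate_succ_apply']; exact ih.D2

theorem Sm.add {f g : ℝ → ℝ → ℂ} (h : Sm f) (h' : Sm g) : Sm (f + g) :=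
  ContDiffOn.add h h'

theorem D1_add {f g : ℝ → ℝ → ℂ} (h : Sm f) (h' : Sm g) : EqQ (D1 (f + g)) (D1 f + D1 g) := by
  intro z w hp
  have e : fderiv ℝ (UU (f + g)) (z, w) = fderiv ℝ (UU f) (z, w) + fderiv ℝ (UU g) (z, w) :=
    fderiv_add (h.diff hp) (h'.diff hp)
  simp only [Pi.add_apply]
  rw [D1_eq (h.add h') hp, D1_eq h hp, D1_eq h' hp, e, _root_.add_apply, mul_add]

theorem D2_add {f g : ℝ → ℝ → ℂ} (h : Sm f) (h' : Sm g) : EqQ (D2 (f + g)) (D2 f + D2 g) := by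
  intro z w hp
  have e : fderiv ℝ (UU (f + g)) (z, w) = fderiv ℝ (UU f) (z, w) + fderiv ℝ (UU g) (z, w) :=
    fderiv_add (h.diff hp) (h'.diff hp)
  simp only [Pi.add_apply]
  rw [D2_eq (h.add h') hp, D2_eq h hp, D2_eq h' hp, e, _root_.add_apply, mul_add]

theorem D1_iter_add {f g : ℝ → ℝ → ℂ} (h : Sm f) (h' : Sm g) (j : ℕ) :
    EqQ (D1^[j] (f + g)) (D1^[j] f + D1^[j] g) := by
  induction j with
  | zero => intro z w _; rfl
  | succ n ih =>
    simp only [Function.iterate_succ_apply']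
    exact ih.D1.trans (D1_add (h.D1_iter n) (h'.D1_iter n))

theorem D2_iter_add {f g : ℝ → ℝ → ℂ} (h : Sm f) (h' : Sm g) (j : ℕ) :
    EqQ (D2^[j] (f + g)) (D2^[j] f + D2^[j] g) := by
  induction j with
  | zero => intro z w _; rfl
  | succ n ih =>
    simp only [Function.iterate_succ_apply']
    exact ih.D2.trans (D2_add (h.D2_iter n) (h'.D2_iter n))

theorem D_comm {f : ℝ → ℝ → ℂ} (h : Sm f) : EqQ (D2 (D1 f)) (D1 (D2 f)) := by
  intro z w hp
  have hd : DifferentiableAt ℝ (fderiv ℝ (UU f)) (z, w) :=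
    ((fderiv_smooth h).contDiffAt (isOpen_QQ.mem_nhds hp)).differentiableAt (by simp)
  have hs : IsSymmSndFDerivAt ℝ (UU f) (z, w) :=
    (h.at hp).isSymmSndFDerivAt (by
      rw [minSmoothness_of_isRCLikeNormedField]
      exact WithTop.coe_le_coe.2 (le_top (a := (2 : ℕ∞))))
  have e1 : (fun w' => D1 f z w') =ᶠ[nhds w]
      (fun w' => (z : ℂ) * fderiv ℝ (UU f) (z, w') (1, 0)) := by
    filter_upwards [ev2 hp] with w' hw' using D1_eq h hw'
  have e2 : (fun z' => D2 f z' w) =ᶠ[nhds z]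
      (fun z' => (w : ℂ) * fderiv ℝ (UU f) (z', w) (0, 1)) := by
    filter_upwards [ev1 hp] with w' hw' using D2_eq h hw'
  have c1 : HasDerivAt (fun w' => fderiv ℝ (UU f) (z, w'))
      (fderiv ℝ (fderiv ℝ (UU f)) (z, w) (0, 1)) w :=
    HasFDerivAt.comp_hasDerivAt (f := fun w' : ℝ => (z, w')) w hd.hasFDerivAt
      (hasDerivAt_line2 z w)
  have c2 : HasDerivAt (fun z' => fderiv ℝ (UU f) (z', w))
      (fderiv ℝ (fderiv ℝ (UU f)) (z, w) (1, 0)) z :=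
    HasFDerivAt.comp_hasDerivAt (f := fun z' : ℝ => (z', w)) z hd.hasFDerivAt
      (hasDerivAt_line1 z w)
  have d1 : HasDerivAt (fun w' => (z : ℂ) * fderiv ℝ (UU f) (z, w') (1, 0))
      (z * fderiv ℝ (fderiv ℝ (UU f)) (z, w) (0, 1) (1, 0)) w := by
    have := (c1.clm_apply (hasDerivAt_const w ((1 : ℝ), (0 : ℝ)))).const_mul (z : ℂ)
    rwa [map_zero, add_zero] at this
  have d2 : HasDerivAt (fun z' => (w : ℂ) * fderiv ℝ (UU f) (z', w) (0, 1))
      (w * fderiv ℝ (fderiv ℝ (UU f)) (z, w) (1, 0) (0, 1)) z := by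
    have := (c2.clm_apply (hasDerivAt_const z ((0 : ℝ), (1 : ℝ)))).const_mul (w : ℂ)
    rwa [map_zero, add_zero] at this
  rw [show D2 (D1 f) z w = w * deriv (fun w' => D1 f z w') w from rfl,
    show D1 (D2 f) z w = z * deriv (fun z' => D2 f z' w) z from rfl,
    e1.deriv_eq, e2.deriv_eq, d1.deriv, d2.deriv, hs.eq (1, 0) (0, 1)]
  ring

theorem D2_iter_D1 {f : ℝ → ℝ → ℂ} (h : Sm f) (k : ℕ) :
    EqQ (D2^[k] (D1 f)) (D1 (D2^[k] f)) := by
  induction k with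
  | zero => intro z w _; rfl
  | succ n ih =>
    simp only [Function.iterate_succ_apply']
    exact ih.D2.trans (D_comm (h.D2_iter n))

theorem mem_blow {s w : ℝ} (hp : (s, w) ∈ QQ) : (s * w, w) ∈ QQ := by
  obtain ⟨⟨h1, h2⟩, h3, h4⟩ := hp
  simp only at h1 h2 h3 h4
  exact ⟨⟨mul_pos h1 h3, by simp only; nlinarith⟩, h3, h4⟩

theorem D1_PP {f : ℝ → ℝ → ℂ} (h : Sm f) : EqQ (D1 (PP f)) (PP (D1 f)) := by
  intro s w hp
  have hl : HasDerivAt (fun s' : ℝ => (s' * w, w)) (1 * w, (0 : ℝ)) s :=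
    ((hasDerivAt_id s).mul_const w).prodMk (hasDerivAt_const s w)
  have hd := (HasFDerivAt.comp_hasDerivAt (f := fun s' : ℝ => (s' * w, w)) s (h.diff (mem_blow hp)).hasFDerivAt hl).deriv
  have e : ((1 * w, (0 : ℝ)) : ℝ × ℝ) = w • ((1 : ℝ), (0 : ℝ)) := by simp
  rw [e, map_smul] at hd
  rw [show PP (D1 f) s w = D1 f (s * w) w from rfl, D1_eq h (mem_blow hp),
    show D1 (PP f) s w = s * deriv (UU f ∘ fun s' : ℝ => (s' * w, w)) s from rfl, hd]
  simp only [Complex.real_smul]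
  push_cast
  ring

theorem D2_PP {f : ℝ → ℝ → ℂ} (h : Sm f) : EqQ (D2 (PP f)) (PP (D1 f + D2 f)) := by
  intro s w hp
  have hl : HasDerivAt (fun w' : ℝ => (s * w', w')) (s * 1, (1 : ℝ)) w :=
    ((hasDerivAt_id w).const_mul s).prodMk (hasDerivAt_id w)
  have hd := (HasFDerivAt.comp_hasDerivAt (f := fun w' : ℝ => (s * w', w')) w (h.diff (mem_blow hp)).hasFDerivAt hl).deriv
  have e : ((s * 1, (1 : ℝ)) : ℝ × ℝ) = s • ((1 : ℝ), (0 : ℝ)) + ((0 : ℝ), (1 : ℝ)) := by simp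
  rw [e, map_add, map_smul] at hd
  rw [show PP (D1 f + D2 f) s w = D1 f (s * w) w + D2 f (s * w) w from rfl,
    D1_eq h (mem_blow hp), D2_eq h (mem_blow hp),
    show D2 (PP f) s w = w * deriv (UU f ∘ fun w' : ℝ => (s * w', w')) w from rfl, hd]
  simp only [Complex.real_smul]
  push_cast
  ring

def Conm (ℓ ℓ' : ℝ) (f : ℝ → ℝ → ℂ) : Prop :=
  Sm f ∧ ∀ j k : ℕ, ∃ C : ℝ, ∀ z w, (z, w) ∈ QQ →
      z ^ (-ℓ) * w ^ (-ℓ') * ‖(D1^[j] (D2^[k] f)) z w‖ ≤ C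

theorem Conm.D1 {ℓ ℓ' : ℝ} {f : ℝ → ℝ → ℂ} (h : Conm ℓ ℓ' f) : Conm ℓ ℓ' (D1 f) := by
  refine ⟨h.1.D1, fun j k => ?_⟩
  obtain ⟨C, hC⟩ := h.2 (j + 1) k
  refine ⟨C, fun z w hp => ?_⟩
  rw [(D2_iter_D1 h.1 k).D1_iter j z w hp]
  exact hC z w hp

theorem Conm.D2 {ℓ ℓ' : ℝ} {f : ℝ → ℝ → ℂ} (h : Conm ℓ ℓ' f) : Conm ℓ ℓ' (D2 f) :=
  ⟨h.1.D2, fun j k => h.2 j (k + 1)⟩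

theorem Conm.add {ℓ ℓ' : ℝ} {f g : ℝ → ℝ → ℂ} (h : Conm ℓ ℓ' f) (h' : Conm ℓ ℓ' g) :
    Conm ℓ ℓ' (f + g) := by
  refine ⟨h.1.add h'.1, fun j k => ?_⟩
  obtain ⟨C, hC⟩ := h.2 j k
  obtain ⟨C', hC'⟩ := h'.2 j k
  refine ⟨C + C', fun z w hp => ?_⟩
  rw [((D2_iter_add h.1 h'.1 k).D1_iter j).trans
    (D1_iter_add (h.1.D2_iter k) (h'.1.D2_iter k) j) z w hp]
  have hz : 0 < z := hp.1.1
  have hw : 0 < w := hp.2.1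
  refine le_trans ?_ (add_le_add (hC z w hp) (hC' z w hp))
  rw [← mul_add]
  exact mul_le_mul_of_nonneg_left (norm_add_le _ _) (by positivity)

theorem iter2 {ℓ ℓ' : ℝ} {f : ℝ → ℝ → ℂ} (h : Conm ℓ ℓ' f) (k : ℕ) :
    ∃ g, Conm ℓ ℓ' g ∧ EqQ (D2^[k] (PP f)) (PP g) := by
  induction k with
  | zero => exact ⟨f, h, fun _ _ _ => rfl⟩
  | succ n ih =>
    obtain ⟨g, hg, e⟩ := ih
    refine ⟨_, hg.D1.add hg.D2, ?_⟩
    rw [Function.iterate_succ_apply']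
    exact e.D2.trans (D2_PP hg.1)

theorem iter1 {ℓ ℓ' : ℝ} {f : ℝ → ℝ → ℂ} (h : Conm ℓ ℓ' f) (j : ℕ) :
    ∃ g, Conm ℓ ℓ' g ∧ EqQ (D1^[j] (PP f)) (PP g) := by
  induction j with
  | zero => exact ⟨f, h, fun _ _ _ => rfl⟩
  | succ n ih =>
    obtain ⟨g, hg, e⟩ := ih
    refine ⟨_, hg.D1, ?_⟩
    rw [Function.iterate_succ_apply']
    exact e.D1.trans (D1_PP hg.1)

/-- Pullback by the blow-down map `(s,w) ↦ (sw, w)` preserves conormality: if `v` is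
conormal on `(0,1)²` with weights `(ℓ, ℓ′)` at `{z=0}` and `{w=0}`, then
`ṽ(s,w) = v(sw, w)` is conormal with weights `(ℓ, ℓ+ℓ′)`. -/
theorem stmt9 (ℓ ℓ' : ℝ) (v : ℝ → ℝ → ℂ)
    (hsm : ContDiffOn ℝ (⊤ : ℕ∞) (fun p : ℝ × ℝ => v p.1 p.2) (Set.Ioo 0 1 ×ˢ Set.Ioo 0 1))
    (hcon : ∀ j k : ℕ, ∃ C : ℝ, ∀ z ∈ Set.Ioo (0 : ℝ) 1, ∀ w ∈ Set.Ioo (0 : ℝ) 1,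
      z ^ (-ℓ) * w ^ (-ℓ') * ‖(D1^[j] (D2^[k] v)) z w‖ ≤ C) :
    ∀ j k : ℕ, ∃ C : ℝ, ∀ s ∈ Set.Ioo (0 : ℝ) 1, ∀ w ∈ Set.Ioo (0 : ℝ) 1,
      s ^ (-ℓ) * w ^ (-(ℓ + ℓ'))
        * ‖(D1^[j] (D2^[k] (fun s' w' => v (s' * w') w'))) s w‖ ≤ C := by
  intro j k
  have h0 : Conm ℓ ℓ' v := by
    refine ⟨hsm, fun j k => ?_⟩
    obtain ⟨C, hC⟩ := hcon j k
    exact ⟨C, fun z w hp => hC z hp.1 w hp.2⟩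
  obtain ⟨g, hg, e⟩ := iter2 h0 k
  obtain ⟨g', hg', e'⟩ := iter1 hg j
  obtain ⟨C, hC⟩ := hg'.2 0 0
  refine ⟨C, fun s hs w hw => ?_⟩
  have hp : (s, w) ∈ QQ := ⟨hs, hw⟩
  have key := (e.D1_iter j).trans e' s w hp
  have hb := hC _ _ (mem_blow hp)
  have hval : (D1^[j] (D2^[k] (fun s' w' => v (s' * w') w'))) s w = g' (s * w) w := key
  rw [hval]
  have hw0 : 0 < w := hw.1
  have : (s * w) ^ (-ℓ) * w ^ (-ℓ') = s ^ (-ℓ) * w ^ (-(ℓ + ℓ')) := by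
    rw [Real.mul_rpow hs.1.le hw0.le, neg_add, Real.rpow_add hw0]
    ring
  rw [← this]
  exact hb
end
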